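/- arXiv:1112.2986 — 3 statements merged into one kernel-verified Lean document; each statement's English description precedes it below -/
import Mathlib

section
/- Integrals against the Gaussian family determine a probability measure: if μ and ν are Borel probability measures on ℝ^m such that ∫ exp(−Σ_{j=1}^n q_j |y − x_j|²) dμ(y) = ∫ exp(−Σ_{j=1}^n q_j |y − x_j|²) dν(y) for every n ∈ ℕ, every choice of rationals q_1,…,q_n > 0 and every choice of x_1,…,x_n ∈ ℚ^m, then μ = ν. -/
open MeasureTheory
open scoped BigOperators

/-- A member of the countable Gaussian family `G_m`: the function
`y ↦ exp(−Σ_{j=1}^n q_j |y − x_j|²)` on `ℝ^m`, with rational `q_j` and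
rational points `x_j ∈ ℚ^m`. -/
noncomputable def gaussFn {m : ℕ} (n : ℕ) (q : Fin n → ℚ) (xs : Fin n → Fin m → ℚ)
    (y : EuclideanSpace ℝ (Fin m)) : ℝ :=
  Real.exp (- ∑ j : Fin n,
    (q j : ℝ) * ‖y - (WithLp.equiv 2 (Fin m → ℝ)).symm (fun i => (xs j i : ℝ))‖ ^ 2)

theorem gaussFn_continuous {m : ℕ} (n : ℕ) (q : Fin n → ℚ) (xs : Fin n → Fin m → ℚ) :
    Continuous (gaussFn n q xs) := by
  unfold gaussFn
  fun_prop

theorem gaussFn_mem_Icc {m : ℕ} (n : ℕ) (q : Fin n → ℚ) (xs : Fin n → Fin m → ℚ)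
    (hq : ∀ j, 0 < q j) (y : EuclideanSpace ℝ (Fin m)) :
    gaussFn n q xs y ∈ Set.Icc (0 : ℝ) 1 := by
  unfold gaussFn
  refine ⟨(Real.exp_pos _).le, Real.exp_le_one_iff.2 (neg_nonpos.2 ?_)⟩
  refine Finset.sum_nonneg fun j _ => mul_nonneg ?_ (by positivity)
  exact_mod_cast (hq j).le

theorem gaussFn_mul {m : ℕ} (n n' : ℕ) (q : Fin n → ℚ) (xs : Fin n → Fin m → ℚ)
    (q' : Fin n' → ℚ) (xs' : Fin n' → Fin m → ℚ) (y : EuclideanSpace ℝ (Fin m)) :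
    gaussFn n q xs y * gaussFn n' q' xs' y =
      gaussFn (n + n') (Fin.append q q') (Fin.append xs xs') y := by
  unfold gaussFn
  rw [← Real.exp_add, Fin.sum_univ_add]
  simp only [Fin.append_left, Fin.append_right]
  congr 1
  ring

/-- The Gaussian family as a submonoid of the bounded continuous functions. -/
def gaussMonoid (m : ℕ) :
    Submonoid (BoundedContinuousFunction (EuclideanSpace ℝ (Fin m)) ℝ) where
  carrier := {f | ∃ (n : ℕ) (q : Fin n → ℚ) (xs : Fin n → Fin m → ℚ), (∀ j, 0 < q j) ∧
    ∀ y, f y = gaussFn n q xs y}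
  one_mem' := ⟨0, Fin.elim0, Fin.elim0, fun j => j.elim0, fun y => by simp [gaussFn]⟩
  mul_mem' := by
    rintro f g ⟨n, q, xs, hq, hf⟩ ⟨n', q', xs', hq', hg⟩
    refine ⟨n + n', Fin.append q q', Fin.append xs xs', fun j => ?_, fun y => ?_⟩
    · refine Fin.addCases (fun i => ?_) (fun i => ?_) j
      · simpa using hq i
      · simpa using hq' i
    · rw [BoundedContinuousFunction.mul_apply, hf, hg, gaussFn_mul]

/-- The algebra spanned by the Gaussian family. -/
noncomputable def gaussAlg (m : ℕ) :
    StarSubalgebra ℝ (BoundedContinuousFunction (EuclideanSpace ℝ (Fin m)) ℝ) where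
  toSubalgebra := Algebra.adjoin ℝ (gaussMonoid m : Set _)
  star_mem' := by
    intro a ha
    have : star a = a := by ext y; simp
    rwa [this]

theorem gauss_exists_rat_near {m : ℕ} (x : EuclideanSpace ℝ (Fin m)) {r : ℝ} (hr : 0 < r) :
    ∃ z : Fin m → ℚ,
      dist x ((WithLp.equiv 2 (Fin m → ℝ)).symm (fun i => (z i : ℝ))) < r := by
  have h1 : DenseRange (Pi.map (fun (_ : Fin m) (a : ℚ) => (a : ℝ))) :=
    DenseRange.piMap fun _ => Rat.denseRange_cast
  have h2 : DenseRange (WithLp.toLp 2 : (Fin m → ℝ) → EuclideanSpace ℝ (Fin m)) :=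
    (WithLp.toLp_surjective 2).denseRange
  have h3 := h2.comp h1 (PiLp.continuous_toLp 2 _)
  obtain ⟨z, hz⟩ := h3.exists_dist_lt x hr
  exact ⟨z, hz⟩

theorem gaussAlg_separates (m : ℕ) :
    ((gaussAlg m).map (BoundedContinuousFunction.toContinuousMapStarₐ ℝ)).SeparatesPoints := by
  intro x y hxy
  obtain ⟨z, hz⟩ := gauss_exists_rat_near x (half_pos (dist_pos.2 hxy))
  set p : EuclideanSpace ℝ (Fin m) :=
    (WithLp.equiv 2 (Fin m → ℝ)).symm (fun i => (z i : ℝ)) with hp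
  let f : BoundedContinuousFunction (EuclideanSpace ℝ (Fin m)) ℝ :=
    BoundedContinuousFunction.ofNormedAddCommGroup (gaussFn 1 (fun _ => 1) (fun _ => z))
      (gaussFn_continuous _ _ _) 1 (fun y => by
        have := gaussFn_mem_Icc 1 (fun _ => 1) (fun _ => z) (fun _ => one_pos) y
        rw [Real.norm_eq_abs, abs_of_nonneg this.1]
        exact this.2)
  refine ⟨f, ⟨f.toContinuousMap, ⟨f, ?_, rfl⟩, rfl⟩, ?_⟩
  · exact Algebra.subset_adjoin ⟨1, _, _, fun _ => one_pos, fun y => rfl⟩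
  · change gaussFn 1 (fun _ => 1) (fun _ => z) x ≠ gaussFn 1 (fun _ => 1) (fun _ => z) y
    simp only [gaussFn, Finset.univ_unique, Finset.sum_singleton, Rat.cast_one, one_mul, ← hp]
    intro h
    have h2 := neg_injective (Real.exp_injective h)
    have h3 : dist x p = dist y p := by
      rw [dist_eq_norm, dist_eq_norm]
      exact (sq_eq_sq₀ (norm_nonneg _) (norm_nonneg _)).1 h2
    have h4 := dist_triangle_right x y p
    linarith

/-- Integrals against the Gaussian family determine a probability measure: if two Borel
probability measures on `ℝ^m` give the same integral to every function
`y ↦ exp(−Σ_{j=1}^n q_j |y − x_j|²)` with positive rationals `q_j` and rational points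
`x_j ∈ ℚ^m`, then the measures coincide. -/
theorem gaussian_family_separates_measures
    (m : ℕ) (μ ν : Measure (EuclideanSpace ℝ (Fin m)))
    [IsProbabilityMeasure μ] [IsProbabilityMeasure ν]
    (h : ∀ (n : ℕ) (q : Fin n → ℚ) (xs : Fin n → Fin m → ℚ), (∀ j, 0 < q j) →
      ∫ y, gaussFn n q xs y ∂μ = ∫ y, gaussFn n q xs y ∂ν) :
    μ = ν := by
  refine ext_of_forall_mem_subalgebra_integral_eq_of_pseudoEMetric_complete_countable
    (gaussAlg_separates m) ?_
  intro g hg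
  have hg' : g ∈ Subalgebra.toSubmodule (Algebra.adjoin ℝ (gaussMonoid m : Set _)) := hg
  rw [Algebra.adjoin_eq_span, Submonoid.closure_eq] at hg'
  clear hg
  induction hg' using Submodule.span_induction with
  | mem f hf =>
    obtain ⟨n, q, xs, hq, hf⟩ := hf
    simp only [hf]
    exact h n q xs hq
  | zero => simp
  | add f g hf hg ihf ihg =>
    simp only [BoundedContinuousFunction.add_apply]
    rw [integral_add (f.integrable μ) (g.integrable μ),
      integral_add (f.integrable ν) (g.integrable ν), ihf, ihg]
  | smul c f hf ih =>
    simp only [BoundedContinuousFunction.smul_apply, integral_smul]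
    rw [ih]
end

section
/- Let (Ω, F, P) be a probability space, let (μ^ε)_{ε ∈ (0,1]} and ν be measurable maps from Ω to the space of Borel probability measures on ℝ^m equipped with the topology of weak convergence, and let r: (0,1] → [0,∞). Suppose there is a constant C₀ > 0 such that for every ε ∈ (0,1] and every φ ∈ C^4_b(ℝ^m), E[ |∫ φ dμ^ε − ∫ φ dν| ] ≤ C₀ r(ε) ‖φ‖_{4,∞}. Then there exist a metric d on the set of Borel probability measures on ℝ^m whose induced topology is the topology of weak convergence, and a constant C > 0, such that E[ d(μ^ε, ν) ] ≤ C r(ε) for every ε ∈ (0,1]. -/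
open MeasureTheory Filter
open scoped BigOperators Topology

/-- `φ ∈ C^k_b(ℝ^m)`: `φ` is `k` times continuously differentiable and `φ` together with
all its derivatives up to order `k` are bounded. -/
def MemCb {m : ℕ} (k : ℕ) (φ : EuclideanSpace ℝ (Fin m) → ℝ) : Prop :=
  ContDiff ℝ k φ ∧ ∀ i ≤ k, ∃ C, ∀ x, ‖iteratedFDeriv ℝ i φ x‖ ≤ C

/-- The norm `‖φ‖_{k,∞}`: the sum of the supremum norms of the derivatives of `φ` of
order `0, 1, …, k`. -/
noncomputable def normCb {m : ℕ} (k : ℕ) (φ : EuclideanSpace ℝ (Fin m) → ℝ) : ℝ :=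
  ∑ i ∈ Finset.range (k + 1), ⨆ x, ‖iteratedFDeriv ℝ i φ x‖


lemma fcm_family (m : ℕ) : ∃ g : ℕ → EuclideanSpace ℝ (Fin m) → ℝ,
    (∀ i, ContDiff ℝ 4 (g i)) ∧ (∀ i, HasCompactSupport (g i)) ∧
    (∀ i x, 0 ≤ g i x) ∧ (∀ i x, g i x ≤ 1) ∧
    ∀ K V : Set (EuclideanSpace ℝ (Fin m)), IsCompact K → IsOpen V → K ⊆ V →
      ∃ i, (∀ x ∈ K, g i x = 1) ∧ ∀ x ∉ V, g i x = 0 := by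
  let E := EuclideanSpace ℝ (Fin m)
  let B := TopologicalSpace.countableBasis E
  have : Countable B := (TopologicalSpace.countable_countableBasis E).to_subtype
  let J := Finset B × ℕ
  let ι := J × ℕ
  let U : J → Set E := fun i => (⋃ b ∈ i.1, (b : Set E)) ∩ Metric.ball 0 (i.2 : ℝ)
  have hU : ∀ i, IsOpen (U i) := fun i =>
    (isOpen_biUnion fun b _ => TopologicalSpace.isOpen_of_mem_countableBasis b.2).inter
      Metric.isOpen_ball
  choose f hfs hfc hfr using fun i => (hU i).exists_contDiff_support_eq (n := 4)
  have : Nonempty ι := ⟨((∅, 0), 0)⟩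
  obtain ⟨e, he⟩ := exists_surjective_nat ι
  refine ⟨fun k x => Real.smoothTransition ((e k).2 * f (e k).1 x), fun k => ?_, fun k => ?_,
    fun k x => Real.smoothTransition.nonneg _, fun k x => Real.smoothTransition.le_one _, ?_⟩
  · exact (Real.smoothTransition.contDiff (n := 4)).comp (contDiff_const.mul (hfc (e k).1))
  · refine HasCompactSupport.intro (isCompact_closedBall (0 : E) ((e k).1.2 : ℝ)) fun x hx => ?_
    have : f (e k).1 x = 0 := by
      rw [← Function.notMem_support, hfs]
      exact fun h => hx (Metric.ball_subset_closedBall h.2)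
    simp [this]
  · intro K V hK hV hKV
    obtain ⟨T, hT1, hT2⟩ : ∃ T : Finset B, K ⊆ (⋃ b ∈ T, (b : Set E)) ∧
        (⋃ b ∈ T, (b : Set E)) ⊆ V := by
      obtain ⟨S, hS⟩ := hK.elim_finite_subcover (fun b : {b : B // (b : Set E) ⊆ V} => (b.1 : Set E))
        (fun b => TopologicalSpace.isOpen_of_mem_countableBasis b.1.2) (by
          intro x hx
          obtain ⟨v, hv, hxv, hvV⟩ :=
            (TopologicalSpace.isBasis_countableBasis E).exists_subset_of_mem_open (hKV hx) hV
          exact Set.mem_iUnion.2 ⟨⟨⟨v, hv⟩, hvV⟩, hxv⟩)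
      classical
      refine ⟨S.image Subtype.val, ?_, ?_⟩
      · intro x hx
        obtain ⟨b, hb, hxb⟩ := Set.mem_iUnion₂.1 (hS hx)
        exact Set.mem_iUnion₂.2 ⟨b.1, Finset.mem_image_of_mem _ hb, hxb⟩
      · intro x hx
        obtain ⟨b, hb, hxb⟩ := Set.mem_iUnion₂.1 hx
        obtain ⟨c, hc, rfl⟩ := Finset.mem_image.1 hb
        exact c.2 hxb
    obtain ⟨R, hR⟩ := hK.isBounded.subset_ball (0 : E)
    obtain ⟨N, hN⟩ := exists_nat_ge R
    have hKU : K ⊆ U (T, N) := fun x hx =>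
      ⟨hT1 hx, Metric.ball_subset_ball hN (hR hx)⟩
    have hpos : ∀ x ∈ K, 0 < f (T, N) x := fun x hx => by
      refine lt_of_le_of_ne (hfr (T, N) ⟨x, rfl⟩).1 (Ne.symm ?_)
      rw [← Function.mem_support, hfs]
      exact hKU hx
    obtain ⟨n, hn⟩ : ∃ n : ℕ, ∀ x ∈ K, 1 ≤ n * f (T, N) x := by
      rcases K.eq_empty_or_nonempty with rfl | hne
      · exact ⟨0, by simp⟩
      obtain ⟨y, hy, hmin⟩ := hK.exists_isMinOn hne (hfc (T, N)).continuous.continuousOn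
      obtain ⟨n, hn⟩ := exists_nat_ge (1 / f (T, N) y)
      refine ⟨n, fun x hx => ?_⟩
      rw [div_le_iff₀ (hpos y hy)] at hn
      exact hn.trans (mul_le_mul_of_nonneg_left (hmin hx) (Nat.cast_nonneg n))
    obtain ⟨k, hk⟩ := he ((T, N), n)
    refine ⟨k, fun x hx => ?_, fun x hx => ?_⟩
    · simp only [hk]
      exact Real.smoothTransition.one_of_one_le (hn x hx)
    · have : f (T, N) x = 0 := by
        rw [← Function.notMem_support, hfs]
        exact fun h => hx (hT2 h.1)
      simp [hk, this]

lemma fcm_memCb {m : ℕ} {g : EuclideanSpace ℝ (Fin m) → ℝ} (hg : ContDiff ℝ 4 g)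
    (hc : HasCompactSupport g) : MemCb 4 g := by
  refine ⟨hg, fun i hi => ?_⟩
  exact (hg.continuous_iteratedFDeriv (by exact_mod_cast hi)).bounded_above_of_compact_support
    (hc.iteratedFDeriv i)

lemma fcm_normCb_nonneg {m : ℕ} (k : ℕ) (g : EuclideanSpace ℝ (Fin m) → ℝ) : 0 ≤ normCb k g :=
  Finset.sum_nonneg fun _ _ => Real.iSup_nonneg fun _ => norm_nonneg _

lemma fcm_continuous {m : ℕ} {g : EuclideanSpace ℝ (Fin m) → ℝ} (hg : Continuous g)
    (h0 : ∀ x, 0 ≤ g x) (h1 : ∀ x, g x ≤ 1) :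
    Continuous fun ρ : ProbabilityMeasure (EuclideanSpace ℝ (Fin m)) =>
      ∫ y, g y ∂(ρ : Measure (EuclideanSpace ℝ (Fin m))) := by
  have hb : ∀ x, ‖g x‖ ≤ 1 := fun x => by
    rw [Real.norm_of_nonneg (h0 x)]; exact h1 x
  exact ProbabilityMeasure.continuous_integral_boundedContinuousFunction
    (BoundedContinuousFunction.ofNormedAddCommGroup g hg 1 hb)

lemma fcm_integrable {m : ℕ} {g : EuclideanSpace ℝ (Fin m) → ℝ} (hg : Continuous g)
    (h0 : ∀ x, 0 ≤ g x) (h1 : ∀ x, g x ≤ 1)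
    (ρ : ProbabilityMeasure (EuclideanSpace ℝ (Fin m))) :
    Integrable g (ρ : Measure (EuclideanSpace ℝ (Fin m))) :=
  Integrable.of_bound hg.aestronglyMeasurable 1 (.of_forall fun x => by
    rw [Real.norm_of_nonneg (h0 x)]; exact h1 x)

lemma fcm_inducing {m : ℕ} {g : ℕ → EuclideanSpace ℝ (Fin m) → ℝ}
    (hg : ∀ i, Continuous (g i)) (h0 : ∀ i x, 0 ≤ g i x) (h1 : ∀ i x, g i x ≤ 1)
    (hK : ∀ K V : Set (EuclideanSpace ℝ (Fin m)), IsCompact K → IsOpen V → K ⊆ V →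
      ∃ i, (∀ x ∈ K, g i x = 1) ∧ ∀ x ∉ V, g i x = 0)
    (c : ℕ → ℝ) (hc : ∀ i, 0 < c i) :
    Topology.IsInducing fun (ρ : ProbabilityMeasure (EuclideanSpace ℝ (Fin m))) (i : ℕ) =>
      c i * ∫ y, g i y ∂(ρ : Measure (EuclideanSpace ℝ (Fin m))) := by
  set Φ := fun (ρ : ProbabilityMeasure (EuclideanSpace ℝ (Fin m))) (i : ℕ) =>
      c i * ∫ y, g i y ∂(ρ : Measure (EuclideanSpace ℝ (Fin m))) with hΦ
  have hcont : Continuous Φ := continuous_pi fun i =>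
    continuous_const.mul (fcm_continuous (hg i) (h0 i) (h1 i))
  rw [Topology.isInducing_iff_nhds]
  intro ρ
  refine le_antisymm hcont.continuousAt.le_comap ?_
  change Tendsto (fun σ => σ) (comap Φ (𝓝 (Φ ρ))) (𝓝 ρ)
  refine tendsto_of_forall_isOpen_le_liminf' fun G hG => ?_
  refine le_of_forall_lt fun a ha => ?_
  obtain ⟨b, hab, hb⟩ := exists_between ha
  obtain ⟨K, hKG, hKc, hbK⟩ := hG.measurableSet.exists_lt_isCompact_of_ne_top
    (measure_ne_top (ρ : Measure (EuclideanSpace ℝ (Fin m))) G) hb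
  refine hab.trans_le (le_liminf_of_le (by isBoundedDefault) ?_)
  obtain ⟨i, hi1, hi0⟩ := hK K G hKc hG hKG
  have hbt : b ≠ ⊤ := (hbK.trans_le le_top).ne
  have e1 : b.toReal < ∫ y, g i y ∂(ρ : Measure (EuclideanSpace ℝ (Fin m))) := by
    have : (ρ : Measure (EuclideanSpace ℝ (Fin m))).real K ≤
        ∫ y, g i y ∂(ρ : Measure (EuclideanSpace ℝ (Fin m))) := by
      rw [← integral_indicator_one hKc.measurableSet]
      refine integral_mono ((integrable_const 1).indicator hKc.measurableSet)
        (fcm_integrable (hg i) (h0 i) (h1 i) ρ) fun x => ?_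
      by_cases hx : x ∈ K
      · simp [hx, hi1 x hx]
      · simp [hx, h0 i x]
    refine lt_of_lt_of_le ?_ this
    exact (ENNReal.toReal_lt_toReal hbt (measure_ne_top _ _)).2 hbK
  have e2 : ∀ᶠ σ in comap Φ (𝓝 (Φ ρ)), c i * b.toReal < Φ σ i := by
    have : Tendsto (fun σ => Φ σ i) (comap Φ (𝓝 (Φ ρ))) (𝓝 (Φ ρ i)) :=
      ((continuous_apply i).tendsto (Φ ρ)).comp tendsto_comap
    exact this.eventually (lt_mem_nhds (mul_lt_mul_of_pos_left e1 (hc i)))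
  filter_upwards [e2] with σ hσ
  have hσ' : b.toReal < ∫ y, g i y ∂(σ : Measure (EuclideanSpace ℝ (Fin m))) :=
    lt_of_mul_lt_mul_left hσ (hc i).le
  have : ∫ y, g i y ∂(σ : Measure (EuclideanSpace ℝ (Fin m))) ≤
      (σ : Measure (EuclideanSpace ℝ (Fin m))).real G := by
    rw [← integral_indicator_one hG.measurableSet]
    refine integral_mono (fcm_integrable (hg i) (h0 i) (h1 i) σ)
      ((integrable_const 1).indicator hG.measurableSet) fun x => ?_
    by_cases hx : x ∈ G
    · simp [hx, h1 i x]
    · simp [hx, hi0 x hx]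
  exact ((ENNReal.toReal_lt_toReal hbt (measure_ne_top _ _)).1 (hσ'.trans_le this)).le

/-- If random probability measures `μ^ε`, `ν` on `ℝ^m` satisfy
`E[|∫ φ dμ^ε − ∫ φ dν|] ≤ C₀ r(ε) ‖φ‖_{4,∞}` for all `φ ∈ C^4_b(ℝ^m)` and `ε ∈ (0,1]`,
then there is a metric `d` on the probability measures on `ℝ^m` generating the topology
of weak convergence and a constant `C > 0` with `E[d(μ^ε, ν)] ≤ C r(ε)` for all
`ε ∈ (0,1]`. -/
theorem filter_convergence_in_metric
    (m : ℕ) (Ω : Type*) [MeasurableSpace Ω] (P : Measure Ω) [IsProbabilityMeasure P]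
    (μ : ℝ → Ω → ProbabilityMeasure (EuclideanSpace ℝ (Fin m)))
    (ν : Ω → ProbabilityMeasure (EuclideanSpace ℝ (Fin m)))
    (hμ : ∀ ε ∈ Set.Ioc (0 : ℝ) 1,
      @Measurable Ω (ProbabilityMeasure (EuclideanSpace ℝ (Fin m))) _
        (borel (ProbabilityMeasure (EuclideanSpace ℝ (Fin m)))) (μ ε))
    (hν : @Measurable Ω (ProbabilityMeasure (EuclideanSpace ℝ (Fin m))) _
        (borel (ProbabilityMeasure (EuclideanSpace ℝ (Fin m)))) ν)
    (r : ℝ → ℝ) (hr : ∀ ε ∈ Set.Ioc (0 : ℝ) 1, 0 ≤ r ε)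
    (C₀ : ℝ) (hC₀ : 0 < C₀)
    (hbound : ∀ ε ∈ Set.Ioc (0 : ℝ) 1, ∀ φ : EuclideanSpace ℝ (Fin m) → ℝ, MemCb 4 φ →
      (∫ ω, |(∫ y, φ y ∂(μ ε ω : Measure (EuclideanSpace ℝ (Fin m)))) -
        ∫ y, φ y ∂(ν ω : Measure (EuclideanSpace ℝ (Fin m)))| ∂P)
        ≤ C₀ * r ε * normCb 4 φ) :
    ∃ mS : MetricSpace (ProbabilityMeasure (EuclideanSpace ℝ (Fin m))),
      mS.toUniformSpace.toTopologicalSpace =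
        (inferInstance : TopologicalSpace (ProbabilityMeasure (EuclideanSpace ℝ (Fin m)))) ∧
      ∃ C > 0, ∀ ε ∈ Set.Ioc (0 : ℝ) 1,
        (∫ ω, @dist _ mS.toDist (μ ε ω) (ν ω) ∂P) ≤ C * r ε := by
  obtain ⟨g, hgd, hgc, h0, h1, hK⟩ := fcm_family m
  have hg : ∀ i, Continuous (g i) := fun i => (hgd i).continuous
  set N : ℕ → ℝ := fun i => normCb 4 (g i) with hN
  have hN0 : ∀ i, 0 ≤ N i := fun i => fcm_normCb_nonneg 4 (g i)
  set c : ℕ → ℝ := fun i => (2⁻¹ : ℝ) ^ i / (1 + N i) with hcdef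
  have hc : ∀ i, 0 < c i := fun i => div_pos (by positivity) (by linarith [hN0 i])
  have hind := fcm_inducing hg h0 h1 hK c hc
  set Φ := fun (ρ : ProbabilityMeasure (EuclideanSpace ℝ (Fin m))) (i : ℕ) =>
      c i * ∫ y, g i y ∂(ρ : Measure (EuclideanSpace ℝ (Fin m))) with hΦ
  refine ⟨MetricSpace.induced Φ hind.injective PiCountable.metricSpace, hind.eq_induced.symm,
    2 * C₀, by linarith, fun ε hε => ?_⟩
  change (∫ ω, ∑' i, min ((2⁻¹ : ℝ) ^ i) (dist (Φ (μ ε ω) i) (Φ (ν ω) i)) ∂P) ≤ _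
  have hmeas : ∀ i, ∀ κ : Ω → ProbabilityMeasure (EuclideanSpace ℝ (Fin m)),
      @Measurable Ω (ProbabilityMeasure (EuclideanSpace ℝ (Fin m))) _
        (borel (ProbabilityMeasure (EuclideanSpace ℝ (Fin m)))) κ →
      Measurable fun ω => ∫ y, g i y ∂(κ ω : Measure (EuclideanSpace ℝ (Fin m))) := by
    intro i κ hκ
    letI : MeasurableSpace (ProbabilityMeasure (EuclideanSpace ℝ (Fin m))) := borel _
    haveI : BorelSpace (ProbabilityMeasure (EuclideanSpace ℝ (Fin m))) := ⟨rfl⟩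
    exact (fcm_continuous (hg i) (h0 i) (h1 i)).measurable.comp hκ
  have hm1 : ∀ i, Measurable fun ω =>
      |(∫ y, g i y ∂(μ ε ω : Measure (EuclideanSpace ℝ (Fin m)))) -
        ∫ y, g i y ∂(ν ω : Measure (EuclideanSpace ℝ (Fin m)))| := fun i =>
    ((hmeas i _ (hμ ε hε)).sub (hmeas i _ hν)).abs
  have hI01 : ∀ i (ρ : ProbabilityMeasure (EuclideanSpace ℝ (Fin m))),
      0 ≤ (∫ y, g i y ∂(ρ : Measure (EuclideanSpace ℝ (Fin m)))) ∧
      (∫ y, g i y ∂(ρ : Measure (EuclideanSpace ℝ (Fin m)))) ≤ 1 := by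
    intro i ρ
    refine ⟨integral_nonneg (h0 i), ?_⟩
    have := integral_mono (fcm_integrable (hg i) (h0 i) (h1 i) ρ) (integrable_const (1 : ℝ)) (h1 i)
    simpa using this
  have hint1 : ∀ i, Integrable (fun ω =>
      |(∫ y, g i y ∂(μ ε ω : Measure (EuclideanSpace ℝ (Fin m)))) -
        ∫ y, g i y ∂(ν ω : Measure (EuclideanSpace ℝ (Fin m)))|) P := by
    intro i
    refine Integrable.of_bound (hm1 i).aestronglyMeasurable 1 (.of_forall fun ω => ?_)
    rw [Real.norm_eq_abs, abs_abs, abs_le]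
    have a := hI01 i (μ ε ω)
    have b := hI01 i (ν ω)
    constructor <;> linarith [a.1, a.2, b.1, b.2]
  have hdist : ∀ i ω, dist (Φ (μ ε ω) i) (Φ (ν ω) i) =
      c i * |(∫ y, g i y ∂(μ ε ω : Measure (EuclideanSpace ℝ (Fin m)))) -
        ∫ y, g i y ∂(ν ω : Measure (EuclideanSpace ℝ (Fin m)))| := by
    intro i ω
    rw [Real.dist_eq, hΦ, ← mul_sub, abs_mul, abs_of_pos (hc i)]
  simp_rw [hdist]
  set F : ℕ → Ω → ℝ := fun i ω => min ((2⁻¹ : ℝ) ^ i)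
    (c i * |(∫ y, g i y ∂(μ ε ω : Measure (EuclideanSpace ℝ (Fin m)))) -
        ∫ y, g i y ∂(ν ω : Measure (EuclideanSpace ℝ (Fin m)))|) with hF
  have hF0 : ∀ i ω, 0 ≤ F i ω := fun i ω =>
    le_min (by positivity) (mul_nonneg (hc i).le (abs_nonneg _))
  have hFint : ∀ i, Integrable (F i) P := fun i =>
    (integrable_const _).inf ((hint1 i).const_mul (c i))
  have hFle : ∀ i, ∫ ω, F i ω ∂P ≤ (2⁻¹ : ℝ) ^ i * (C₀ * r ε) := by
    intro i
    calc ∫ ω, F i ω ∂P ≤ ∫ ω, c i * |(∫ y, g i y ∂(μ ε ω : Measure (EuclideanSpace ℝ (Fin m)))) -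
        ∫ y, g i y ∂(ν ω : Measure (EuclideanSpace ℝ (Fin m)))| ∂P :=
          integral_mono (hFint i) ((hint1 i).const_mul (c i)) fun ω => min_le_right _ _
      _ ≤ c i * (C₀ * r ε * N i) := by
          rw [integral_const_mul]
          exact mul_le_mul_of_nonneg_left (hbound ε hε _ (fcm_memCb (hgd i) (hgc i))) (hc i).le
      _ = (2⁻¹ : ℝ) ^ i * (C₀ * r ε) * (N i / (1 + N i)) := by
          simp only [hcdef]; ring
      _ ≤ (2⁻¹ : ℝ) ^ i * (C₀ * r ε) := by
          have := hr ε hε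
          refine mul_le_of_le_one_right (by positivity) ?_
          rw [div_le_one (by linarith [hN0 i])]
          linarith
  have hgeo : Summable fun i : ℕ => (2⁻¹ : ℝ) ^ i := by
    simpa [one_div] using summable_geometric_two
  have hsum : Summable fun i => ∫ ω, F i ω ∂P :=
    Summable.of_nonneg_of_le (fun i => integral_nonneg (hF0 i)) hFle (hgeo.mul_right _)
  have hH := hasSum_integral_of_summable_integral_norm hFint (by
    simpa only [Real.norm_of_nonneg (hF0 _ _)] using hsum)
  change (∫ ω, ∑' i, F i ω ∂P) ≤ _
  rw [← hH.tsum_eq]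
  calc ∑' i, ∫ ω, F i ω ∂P ≤ ∑' i : ℕ, (2⁻¹ : ℝ) ^ i * (C₀ * r ε) :=
        hsum.tsum_le_tsum hFle (hgeo.mul_right _)
    _ = 2 * C₀ * r ε := by rw [tsum_mul_right, tsum_geometric_inv_two]; ring
end

section
/- Let p ≥ 1 and K > 0, let (Ω, F, P) be a probability space, and let μ, ν be measurable maps from Ω to the space of Borel probability measures on ℝ^m. Suppose that for every φ ∈ C^7_b(ℝ^m), E[ |∫ φ dμ − ∫ φ dν|^p ] ≤ K ‖φ‖_{4,∞}^p. Then the same bound holds for every φ ∈ C^4_b(ℝ^m): E[ |∫ φ dμ − ∫ φ dν|^p ] ≤ K ‖φ‖_{4,∞}^p. -/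
open MeasureTheory
open scoped BigOperators

open Filter Topology

/-- Convolution of a smooth compactly supported function with a bounded continuous one has
bounded derivatives of all orders. -/
theorem conv_deriv_bounded {G : Type} [NormedAddCommGroup G] [NormedSpace ℝ G]
    [MeasurableSpace G] [BorelSpace G] [FiniteDimensional ℝ G]
    (vol : Measure G) [vol.IsAddHaarMeasure]
    (g : G → ℝ) (hg : Continuous g) (C : ℝ) (hC : ∀ x, ‖g x‖ ≤ C) (n : ℕ) :
    ∀ (E F : Type) [NormedAddCommGroup E] [NormedSpace ℝ E]
      [NormedAddCommGroup F] [NormedSpace ℝ F] [CompleteSpace F] (L : E →L[ℝ] ℝ →L[ℝ] F) (f : G → E),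
      ContDiff ℝ (⊤ : ℕ∞) f → HasCompactSupport f →
      ∃ D, ∀ x, ‖iteratedFDeriv ℝ n (convolution f g L vol) x‖ ≤ D := by
  induction n with
  | zero =>
    intro E F _ _ _ _ _ L f hf hfc
    refine ⟨∫ t, ‖L‖ * ‖f t‖ * C ∂vol, fun x => ?_⟩
    rw [norm_iteratedFDeriv_zero, convolution_def]
    refine norm_integral_le_of_norm_le ?_ (Eventually.of_forall fun t => ?_)
    · have := (hf.continuous.integrable_of_hasCompactSupport (μ := vol) hfc).norm
      exact (this.const_mul _).mul_const _
    · refine (L.le_opNorm₂ _ _).trans ?_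
      gcongr
      exact hC _
  | succ n ih =>
    intro E F _ _ _ _ _ L f hf hfc
    have hfd : fderiv ℝ (convolution f g L vol)
        = convolution (fderiv ℝ f) g (L.precompL G) vol := by
      funext x
      exact (hfc.hasFDerivAt_convolution_left L (hf.of_le (by simp)) hg.locallyIntegrable x).fderiv
    obtain ⟨D, hD⟩ := ih (G →L[ℝ] E) (G →L[ℝ] F) (L.precompL G) (fderiv ℝ f)
      (hf.fderiv_right (by simp)) (hfc.fderiv ℝ)
    refine ⟨D, fun x => ?_⟩
    rw [← norm_iteratedFDeriv_fderiv, hfd]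
    exact hD x

/-- Averaging translates against a probability density does not increase derivative bounds. -/
theorem avg_deriv_le {G : Type} [NormedAddCommGroup G] [NormedSpace ℝ G]
    [MeasurableSpace G] [BorelSpace G] [FiniteDimensional ℝ G]
    (vol : Measure G) (b : G → ℝ) (hb0 : ∀ t, 0 ≤ b t) (hbc : Continuous b)
    (hbi : Integrable b vol) (hb1 : ∫ t, b t ∂vol = 1) (n : ℕ) :
    ∀ (E : Type) [NormedAddCommGroup E] [NormedSpace ℝ E] [CompleteSpace E] (g : G → E),
      ContDiff ℝ n g → (∀ i ≤ n, ∃ C, ∀ x, ‖iteratedFDeriv ℝ i g x‖ ≤ C) →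
      ∀ C, (∀ x, ‖iteratedFDeriv ℝ n g x‖ ≤ C) →
      ∀ x, ‖iteratedFDeriv ℝ n (fun y => ∫ t, b t • g (y - t) ∂vol) x‖ ≤ C := by
  induction n with
  | zero =>
    intro E _ _ _ g hg _ C hC x
    rw [norm_iteratedFDeriv_zero]
    have : ∫ t, b t * C ∂vol = C := by rw [integral_mul_const, hb1, one_mul]
    rw [← this]
    refine norm_integral_le_of_norm_le (hbi.mul_const _) (Eventually.of_forall fun t => ?_)
    rw [norm_smul, Real.norm_of_nonneg (hb0 t)]
    have := hC (x - t)
    rw [norm_iteratedFDeriv_zero] at this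
    exact mul_le_mul_of_nonneg_left this (hb0 t)
  | succ n ih =>
    intro E _ _ _ g hg hbd C hC x
    have hgc : Continuous g := hg.continuous
    have hg1 : ContDiff ℝ 1 g := hg.of_le (by norm_cast; omega)
    have hg'c : Continuous (fderiv ℝ g) := hg1.continuous_fderiv (by simp)
    obtain ⟨C0, hC0⟩ := hbd 0 (by omega)
    obtain ⟨C1, hC1⟩ := hbd 1 (by omega)
    simp only [norm_iteratedFDeriv_zero] at hC0
    simp only [norm_iteratedFDeriv_one] at hC1
    have hfd : fderiv ℝ (fun y => ∫ t, b t • g (y - t) ∂vol)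
        = fun y => ∫ t, b t • fderiv ℝ g (y - t) ∂vol := by
      funext y
      refine (hasFDerivAt_integral_of_dominated_of_fderiv_le (s := Set.univ)
        (F := fun y t => b t • g (y - t)) (F' := fun y t => b t • fderiv ℝ g (y - t))
        (bound := fun t => b t * C1) univ_mem
        (Eventually.of_forall fun z => ?_) ?_ ?_ ?_ (hbi.mul_const _) ?_).fderiv
      · exact (by fun_prop : Continuous fun t => b t • g (z - t)).aestronglyMeasurable
      · refine (hbi.mul_const C0).mono'
          (by fun_prop : Continuous fun t => b t • g (y - t)).aestronglyMeasurable
          (Eventually.of_forall fun t => ?_)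
        rw [norm_smul, Real.norm_of_nonneg (hb0 t)]
        exact mul_le_mul_of_nonneg_left (hC0 _) (hb0 t)
      · exact (by fun_prop : Continuous fun t => b t • fderiv ℝ g (y - t)).aestronglyMeasurable
      · refine Eventually.of_forall fun t z _ => ?_
        rw [norm_smul, Real.norm_of_nonneg (hb0 t)]
        exact mul_le_mul_of_nonneg_left (hC1 _) (hb0 t)
      · refine Eventually.of_forall fun t z _ => ?_
        have h := ((hg1.differentiable (by simp)) (z - t)).hasFDerivAt
        have h2 : HasFDerivAt (fun z : G => z - t) (ContinuousLinearMap.id ℝ G) z :=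
          (hasFDerivAt_id z).sub_const t
        have h3 := (h.comp z h2).const_smul (b t)
        rw [ContinuousLinearMap.comp_id] at h3
        exact h3
    rw [← norm_iteratedFDeriv_fderiv, hfd]
    refine ih (G →L[ℝ] E) (fderiv ℝ g) (hg.fderiv_right (by norm_cast)) ?_ C ?_ x
    · intro i hi
      obtain ⟨D, hD⟩ := hbd (i + 1) (by omega)
      exact ⟨D, fun z => by rw [norm_iteratedFDeriv_fderiv]; exact hD z⟩
    · intro z
      rw [norm_iteratedFDeriv_fderiv]; exact hC z

/-- Smooth approximation of a `C^4_b` function. -/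
theorem exists_mollification {m : ℕ} (φ : EuclideanSpace ℝ (Fin m) → ℝ) (hφ : MemCb 4 φ) :
    ∃ ψ : ℕ → EuclideanSpace ℝ (Fin m) → ℝ, (∀ n, MemCb 7 (ψ n)) ∧
      (∀ n, normCb 4 (ψ n) ≤ normCb 4 φ) ∧
      (∀ n C, (∀ x, ‖φ x‖ ≤ C) → ∀ x, ‖ψ n x‖ ≤ C) ∧
      ∀ x, Tendsto (fun n => ψ n x) atTop (𝓝 (φ x)) := by
  have hpos : ∀ n : ℕ, (0 : ℝ) < 1 / (n + 1) := fun n => by positivity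
  let B : ℕ → ContDiffBump (0 : EuclideanSpace ℝ (Fin m)) := fun n =>
    { rIn := 1 / (n + 1) / 2, rOut := 1 / (n + 1), rIn_pos := half_pos (hpos n),
      rIn_lt_rOut := half_lt_self (hpos n) }
  have hφc : Continuous φ := hφ.1.continuous
  obtain ⟨C0, hC0⟩ := hφ.2 0 (by omega)
  simp only [norm_iteratedFDeriv_zero] at hC0
  have key : ∀ n i, i ≤ 4 → ∀ C, (∀ x, ‖iteratedFDeriv ℝ i φ x‖ ≤ C) → ∀ x,
      ‖iteratedFDeriv ℝ i (convolution ((B n).normed volume) φ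
        (ContinuousLinearMap.lsmul ℝ ℝ) volume) x‖ ≤ C := by
    intro n i hi C hC x
    exact avg_deriv_le volume ((B n).normed volume) (fun t => (B n).nonneg_normed t)
      (B n).continuous_normed (B n).integrable_normed (B n).integral_normed i ℝ φ
      (hφ.1.of_le (by exact_mod_cast hi)) (fun j hj => hφ.2 j (hj.trans hi)) C hC x
  refine ⟨fun n => convolution ((B n).normed volume) φ
        (ContinuousLinearMap.lsmul ℝ ℝ) volume, fun n => ⟨?_, fun i _ => ?_⟩, fun n => ?_, ?_, ?_⟩
  · exact (B n).hasCompactSupport_normed.contDiff_convolution_left _ (B n).contDiff_normed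
      hφc.locallyIntegrable
  · exact conv_deriv_bounded volume φ hφc C0 hC0 i ℝ ℝ _ _ (B n).contDiff_normed
      (B n).hasCompactSupport_normed
  · refine Finset.sum_le_sum fun i hi => ?_
    have hi4 : i ≤ 4 := by simpa [Nat.lt_succ_iff] using hi
    refine ciSup_le fun x => key n i hi4 _ (fun z => ?_) x
    obtain ⟨D, hD⟩ := hφ.2 i hi4
    exact le_ciSup (f := fun x => ‖iteratedFDeriv ℝ i φ x‖) ⟨D, by rintro _ ⟨y, rfl⟩; exact hD y⟩ z
  · intro n C hC x
    have := key n 0 (by omega) C (by simpa only [norm_iteratedFDeriv_zero] using hC) x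
    simpa only [norm_iteratedFDeriv_zero] using this
  · intro x
    exact ContDiffBump.convolution_tendsto_right_of_continuous (φ := B)
      (tendsto_one_div_add_atTop_nhds_zero_nat) hφc x

theorem normCb_nonneg {m : ℕ} (k : ℕ) (φ : EuclideanSpace ℝ (Fin m) → ℝ) : 0 ≤ normCb k φ :=
  Finset.sum_nonneg fun _ _ => Real.iSup_nonneg fun _ => norm_nonneg _

theorem measurable_integral_pm {m : ℕ} {Ω : Type*} [MeasurableSpace Ω]
    (μ : Ω → ProbabilityMeasure (EuclideanSpace ℝ (Fin m)))
    (hμ : @Measurable Ω (ProbabilityMeasure (EuclideanSpace ℝ (Fin m))) _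
        (borel (ProbabilityMeasure (EuclideanSpace ℝ (Fin m)))) μ)
    (f : EuclideanSpace ℝ (Fin m) → ℝ) (hf : Continuous f) (C : ℝ) (hC : ∀ x, ‖f x‖ ≤ C) :
    Measurable fun ω => ∫ y, f y ∂(μ ω : Measure (EuclideanSpace ℝ (Fin m))) := by
  letI : MeasurableSpace (ProbabilityMeasure (EuclideanSpace ℝ (Fin m))) := borel _
  haveI : BorelSpace (ProbabilityMeasure (EuclideanSpace ℝ (Fin m))) := ⟨rfl⟩
  have hc := ProbabilityMeasure.continuous_integral_boundedContinuousFunction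
    (BoundedContinuousFunction.ofNormedAddCommGroup f hf C hC)
  exact hc.measurable.comp hμ

/-- If random probability measures `μ`, `ν` on `ℝ^m` satisfy
`E[|∫ φ dμ − ∫ φ dν|^p] ≤ K ‖φ‖_{4,∞}^p` for every `φ ∈ C^7_b(ℝ^m)`, then the same
bound holds for every `φ ∈ C^4_b(ℝ^m)`. -/
theorem bound_extends_from_C7b_to_C4b
    (m : ℕ) (p : ℝ) (hp : 1 ≤ p) (K : ℝ) (hK : 0 < K)
    (Ω : Type*) [MeasurableSpace Ω] (P : Measure Ω) [IsProbabilityMeasure P]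
    (μ ν : Ω → ProbabilityMeasure (EuclideanSpace ℝ (Fin m)))
    (hμ : @Measurable Ω (ProbabilityMeasure (EuclideanSpace ℝ (Fin m))) _
        (borel (ProbabilityMeasure (EuclideanSpace ℝ (Fin m)))) μ)
    (hν : @Measurable Ω (ProbabilityMeasure (EuclideanSpace ℝ (Fin m))) _
        (borel (ProbabilityMeasure (EuclideanSpace ℝ (Fin m)))) ν)
    (h7 : ∀ φ : EuclideanSpace ℝ (Fin m) → ℝ, MemCb 7 φ →
      (∫ ω, |(∫ y, φ y ∂(μ ω : Measure (EuclideanSpace ℝ (Fin m)))) -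
        ∫ y, φ y ∂(ν ω : Measure (EuclideanSpace ℝ (Fin m)))| ^ p ∂P)
        ≤ K * normCb 4 φ ^ p) :
    ∀ φ : EuclideanSpace ℝ (Fin m) → ℝ, MemCb 4 φ →
      (∫ ω, |(∫ y, φ y ∂(μ ω : Measure (EuclideanSpace ℝ (Fin m)))) -
        ∫ y, φ y ∂(ν ω : Measure (EuclideanSpace ℝ (Fin m)))| ^ p ∂P)
        ≤ K * normCb 4 φ ^ p := by
  intro φ hφ
  obtain ⟨ψ, hψ7, hψn, hψb, hψt⟩ := exists_mollification φ hφ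
  obtain ⟨C, hC⟩ := hφ.2 0 (by omega)
  simp only [norm_iteratedFDeriv_zero] at hC
  have hp0 : 0 ≤ p := by linarith
  have hint : ∀ (ρ : ProbabilityMeasure (EuclideanSpace ℝ (Fin m))) n,
      ‖∫ y, ψ n y ∂(ρ : Measure (EuclideanSpace ℝ (Fin m)))‖ ≤ C := by
    intro ρ n
    have := norm_integral_le_of_norm_le_const (μ := (ρ : Measure (EuclideanSpace ℝ (Fin m))))
      (Eventually.of_forall (hψb n C hC))
    simpa using this
  have hlim : ∀ (ρ : ProbabilityMeasure (EuclideanSpace ℝ (Fin m))),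
      Tendsto (fun n => ∫ y, ψ n y ∂(ρ : Measure (EuclideanSpace ℝ (Fin m)))) atTop
        (𝓝 (∫ y, φ y ∂(ρ : Measure (EuclideanSpace ℝ (Fin m))))) := by
    intro ρ
    refine tendsto_integral_of_dominated_convergence (fun _ => C)
      (fun n => (hψ7 n).1.continuous.aestronglyMeasurable) (integrable_const _)
      (fun n => Eventually.of_forall (hψb n C hC)) (Eventually.of_forall hψt)
  have hmain : Tendsto (fun n => ∫ ω, |(∫ y, ψ n y ∂(μ ω : Measure (EuclideanSpace ℝ (Fin m)))) -
        ∫ y, ψ n y ∂(ν ω : Measure (EuclideanSpace ℝ (Fin m)))| ^ p ∂P) atTop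
      (𝓝 (∫ ω, |(∫ y, φ y ∂(μ ω : Measure (EuclideanSpace ℝ (Fin m)))) -
        ∫ y, φ y ∂(ν ω : Measure (EuclideanSpace ℝ (Fin m)))| ^ p ∂P)) := by
    refine tendsto_integral_of_dominated_convergence (fun _ => (C + C) ^ p)
      (fun n => ?_) (integrable_const _) (fun n => Eventually.of_forall fun ω => ?_)
      (Eventually.of_forall fun ω => ?_)
    · have h1 := measurable_integral_pm μ hμ (ψ n) (hψ7 n).1.continuous C (hψb n C hC)
      have h2 := measurable_integral_pm ν hν (ψ n) (hψ7 n).1.continuous C (hψb n C hC)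
      exact ((continuous_abs.measurable.comp (h1.sub h2)).pow_const p).aestronglyMeasurable
    · rw [Real.norm_of_nonneg (by positivity)]
      refine Real.rpow_le_rpow (abs_nonneg _) ?_ hp0
      exact (norm_sub_le _ _).trans (add_le_add (hint _ n) (hint _ n))
    · exact (((hlim (μ ω)).sub (hlim (ν ω))).abs).rpow_const (Or.inr hp0)
  refine le_of_tendsto hmain (Eventually.of_forall fun n => (h7 (ψ n) (hψ7 n)).trans ?_)
  exact mul_le_mul_of_nonneg_left
    (Real.rpow_le_rpow (normCb_nonneg 4 _) (hψn n) hp0) hK.le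
end
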